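/- Let DMU_o = (x_o,y_o), o ∈ J, be FDH_V-efficient and suppose G-IRS prevails at DMU_o. Then the maximum incremental ratio satisfies σ_o^+ = max_{j ∈ Π} (β_{jo} − 1)/(α_{jo} − 1), where Π := {j ∈ J : α_{jo} > 1} (which is nonempty); in particular the supremum defining σ_o^+ is finite and attained. -/

import Mathlib

open Set

noncomputable section

/-- The FDH variable-returns-to-scale technology:
`T = {(x,y) : y ≥ 0 and ∃ j, x_j ≤ x and y ≤ y_j}`. -/
def FDH {n m s : ℕ} (x : Fin n → Fin m → ℝ) (y : Fin n → Fin s → ℝ) :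
    Set ((Fin m → ℝ) × (Fin s → ℝ)) :=
  {p | (∀ r, 0 ≤ p.2 r) ∧ ∃ j : Fin n, (∀ i, x j i ≤ p.1 i) ∧ (∀ r, p.2 r ≤ y j r)}

/-- DMU_o is FDH_V-efficient: no (x,y) ∈ T with x ≤ x_o, y ≥ y_o, (x,y) ≠ (x_o,y_o). -/
def FDHEfficient {n m s : ℕ} (x : Fin n → Fin m → ℝ) (y : Fin n → Fin s → ℝ)
    (o : Fin n) : Prop :=
  ¬ ∃ p ∈ FDH x y, (∀ i, p.1 i ≤ x o i) ∧ (∀ r, y o r ≤ p.2 r) ∧ p ≠ (x o, y o)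

/-- `α_{jo} = max_i x_{ij} / x_{io}`. -/
def alphaRatio {n m s : ℕ} (x : Fin n → Fin m → ℝ) (_y : Fin n → Fin s → ℝ)
    (o j : Fin n) : ℝ :=
  ⨆ i : Fin m, x j i / x o i

/-- `β_{jo} = min_r y_{rj} / y_{ro}`. -/
def betaRatio {n m s : ℕ} (_x : Fin n → Fin m → ℝ) (y : Fin n → Fin s → ℝ)
    (o j : Fin n) : ℝ :=
  ⨅ r : Fin s, y j r / y o r

/-- `θ_o(D) = inf {θ : ∃ j ∈ J, δ ∈ D, δ x_j ≤ θ x_o, δ y_j ≥ y_o}`. -/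
def thetaEff {n m s : ℕ} (x : Fin n → Fin m → ℝ) (y : Fin n → Fin s → ℝ)
    (o : Fin n) (D : Set ℝ) : ℝ :=
  sInf {θ : ℝ | ∃ j : Fin n, ∃ δ ∈ D,
    (∀ i, δ * x j i ≤ θ * x o i) ∧ (∀ r, y o r ≤ δ * y j r)}

/-- G-IRS prevails at DMU_o iff `θ_o^{ND} > θ_o^{C} = θ_o^{NI}`. -/
def GIRS {n m s : ℕ} (x : Fin n → Fin m → ℝ) (y : Fin n → Fin s → ℝ)
    (o : Fin n) : Prop :=
  thetaEff x y o (Ici 1) > thetaEff x y o (Ici 0) ∧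
    thetaEff x y o (Ici 0) = thetaEff x y o (Icc 0 1)

/-- G-DRS prevails at DMU_o iff `θ_o^{NI} > θ_o^{C} = θ_o^{ND}`. -/
def GDRS {n m s : ℕ} (x : Fin n → Fin m → ℝ) (y : Fin n → Fin s → ℝ)
    (o : Fin n) : Prop :=
  thetaEff x y o (Icc 0 1) > thetaEff x y o (Ici 0) ∧
    thetaEff x y o (Ici 0) = thetaEff x y o (Ici 1)

/-- G-CRS prevails at DMU_o iff `θ_o^{C} = θ_o^{NI} = θ_o^{ND} = 1`. -/
def GCRS {n m s : ℕ} (x : Fin n → Fin m → ℝ) (y : Fin n → Fin s → ℝ)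
    (o : Fin n) : Prop :=
  thetaEff x y o (Ici 0) = 1 ∧ thetaEff x y o (Icc 0 1) = 1 ∧
    thetaEff x y o (Ici 1) = 1

/-- G-SCRS prevails at DMU_o iff `θ_o^{C} = θ_o^{NI} = θ_o^{ND} < 1`. -/
def GSCRS {n m s : ℕ} (x : Fin n → Fin m → ℝ) (y : Fin n → Fin s → ℝ)
    (o : Fin n) : Prop :=
  thetaEff x y o (Ici 0) = thetaEff x y o (Icc 0 1) ∧
    thetaEff x y o (Icc 0 1) = thetaEff x y o (Ici 1) ∧
    thetaEff x y o (Ici 1) < 1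

/-- Response function `β_o(α) = sup {β : (α x_o, β y_o) ∈ T}`. -/
def respFun {n m s : ℕ} (x : Fin n → Fin m → ℝ) (y : Fin n → Fin s → ℝ)
    (o : Fin n) (α : ℝ) : ℝ :=
  sSup {β : ℝ | ((fun i => α * x o i), (fun r => β * y o r)) ∈ FDH x y}

/-- Maximum incremental ratio `σ_o^+ = sup_{α > 1} (β_o(α) - 1)/(α - 1)`. -/
def sigmaPlus {n m s : ℕ} (x : Fin n → Fin m → ℝ) (y : Fin n → Fin s → ℝ)
    (o : Fin n) : ℝ :=
  sSup {ρ : ℝ | ∃ α : ℝ, 1 < α ∧ ρ = (respFun x y o α - 1) / (α - 1)}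

/-- Minimum decremental ratio `σ_o^- = inf {(β_o(α)-1)/(α-1) : α < 1 feasible}`,
taken in the extended reals (so it is `+∞` when no `α < 1` is feasible). -/
def sigmaMinus {n m s : ℕ} (x : Fin n → Fin m → ℝ) (y : Fin n → Fin s → ℝ)
    (o : Fin n) : EReal :=
  sInf {ρ : EReal | ∃ α : ℝ, α < 1 ∧
    (∃ β : ℝ, ((fun i => α * x o i), (fun r => β * y o r)) ∈ FDH x y) ∧
    ρ = (((respFun x y o α - 1) / (α - 1) : ℝ) : EReal)}

/-- Right-IRS: `(δ x_o, δ y_o) ∈ int T` for some `δ > 1`. -/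
def RightIRS {n m s : ℕ} (x : Fin n → Fin m → ℝ) (y : Fin n → Fin s → ℝ)
    (o : Fin n) : Prop :=
  ∃ δ : ℝ, 1 < δ ∧
    ((fun i => δ * x o i), (fun r => δ * y o r)) ∈ interior (FDH x y)

/-- Right-DRS: `(δ x_o, δ y_o) ∉ T` for every `δ > 1`. -/
def RightDRS {n m s : ℕ} (x : Fin n → Fin m → ℝ) (y : Fin n → Fin s → ℝ)
    (o : Fin n) : Prop :=
  ∀ δ : ℝ, 1 < δ →
    ((fun i => δ * x o i), (fun r => δ * y o r)) ∉ FDH x y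

/-- Right-CRS: neither Right-IRS nor Right-DRS. -/
def RightCRS {n m s : ℕ} (x : Fin n → Fin m → ℝ) (y : Fin n → Fin s → ℝ)
    (o : Fin n) : Prop :=
  ¬ RightIRS x y o ∧ ¬ RightDRS x y o

/-- Left-IRS: `(δ x_o, δ y_o) ∉ T` for every `δ ∈ (0,1)`. -/
def LeftIRS {n m s : ℕ} (x : Fin n → Fin m → ℝ) (y : Fin n → Fin s → ℝ)
    (o : Fin n) : Prop :=
  ∀ δ : ℝ, 0 < δ → δ < 1 →
    ((fun i => δ * x o i), (fun r => δ * y o r)) ∉ FDH x y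

/-- Left-DRS: `(δ x_o, δ y_o) ∈ int T` for some `δ ∈ (0,1)`. -/
def LeftDRS {n m s : ℕ} (x : Fin n → Fin m → ℝ) (y : Fin n → Fin s → ℝ)
    (o : Fin n) : Prop :=
  ∃ δ : ℝ, 0 < δ ∧ δ < 1 ∧
    ((fun i => δ * x o i), (fun r => δ * y o r)) ∈ interior (FDH x y)

/-- Left-CRS: neither Left-IRS nor Left-DRS. -/
def LeftCRS {n m s : ℕ} (x : Fin n → Fin m → ℝ) (y : Fin n → Fin s → ℝ)
    (o : Fin n) : Prop :=
  ¬ LeftIRS x y o ∧ ¬ LeftDRS x y o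

lemma alpha_le_iff {n m s : ℕ} (hm : 0 < m)
    (x : Fin n → Fin m → ℝ) (y : Fin n → Fin s → ℝ)
    (hx : ∀ j i, 0 < x j i) (o j : Fin n) (α : ℝ) :
    alphaRatio x y o j ≤ α ↔ ∀ i, x j i ≤ α * x o i := by
  haveI : Nonempty (Fin m) := ⟨⟨0, hm⟩⟩
  unfold alphaRatio
  rw [ciSup_le_iff (Set.finite_range _).bddAbove]
  exact forall_congr' fun i => div_le_iff₀ (hx o i)

lemma le_beta_iff {n m s : ℕ} (hs : 0 < s)
    (x : Fin n → Fin m → ℝ) (y : Fin n → Fin s → ℝ)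
    (hy : ∀ j r, 0 < y j r) (o j : Fin n) (β : ℝ) :
    β ≤ betaRatio x y o j ↔ ∀ r, β * y o r ≤ y j r := by
  haveI : Nonempty (Fin s) := ⟨⟨0, hs⟩⟩
  unfold betaRatio
  rw [le_ciInf_iff (Set.finite_range _).bddBelow]
  exact forall_congr' fun i => le_div_iff₀ (hy o i)

lemma resp_set {n m s : ℕ} (hm : 0 < m) (hs : 0 < s)
    (x : Fin n → Fin m → ℝ) (y : Fin n → Fin s → ℝ)
    (hx : ∀ j i, 0 < x j i) (hy : ∀ j r, 0 < y j r) (o : Fin n) (α β : ℝ) :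
    ((fun i => α * x o i), (fun r => β * y o r)) ∈ FDH x y ↔
      0 ≤ β ∧ ∃ j, alphaRatio x y o j ≤ α ∧ β ≤ betaRatio x y o j := by
  simp only [alpha_le_iff hm x y hx, le_beta_iff hs x y hy]
  simp only [FDH, mem_setOf_eq]
  refine and_congr ⟨fun h => ?_, fun h r => mul_nonneg h (hy o r).le⟩ Iff.rfl
  exact nonneg_of_mul_nonneg_left (h ⟨0, hs⟩) (hy o _)

lemma eff_beta {n m s : ℕ} (hm : 0 < m) (hs : 0 < s)
    (x : Fin n → Fin m → ℝ) (y : Fin n → Fin s → ℝ)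
    (hx : ∀ j i, 0 < x j i) (hy : ∀ j r, 0 < y j r)
    (o : Fin n) (heff : FDHEfficient x y o) (j : Fin n)
    (hb : 1 < betaRatio x y o j) : 1 < alphaRatio x y o j := by
  by_contra h
  have ha := (alpha_le_iff hm x y hx o j 1).1 (not_lt.1 h)
  have hbb := (le_beta_iff hs x y hy o j _).1 le_rfl
  refine heff ⟨(x j, y j), ⟨fun r => (hy j r).le, j, fun _ => le_rfl, fun _ => le_rfl⟩, ?_, ?_, ?_⟩
  · intro i
    simpa using ha i
  · intro r
    have := hbb r
    have := hy o r
    show y o r ≤ y j r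
    nlinarith
  · intro he
    have h1 : y j ⟨0, hs⟩ = y o ⟨0, hs⟩ := congrFun (congrArg Prod.snd he) _
    have := hbb ⟨0, hs⟩
    have := hy o ⟨0, hs⟩
    nlinarith

lemma girs_exists {n m s : ℕ} (hm : 0 < m) (hs : 0 < s)
    (x : Fin n → Fin m → ℝ) (y : Fin n → Fin s → ℝ)
    (hx : ∀ j i, 0 < x j i) (hy : ∀ j r, 0 < y j r)
    (o : Fin n) (heff : FDHEfficient x y o) (hgirs : GIRS x y o) :
    ∃ j, 1 < betaRatio x y o j := by
  have h1 : thetaEff x y o (Ici 1) ≤ 1 := by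
    apply csInf_le
    · refine ⟨0, ?_⟩
      rintro θ ⟨j, δ, hδ, h, -⟩
      have h0 := h ⟨0, hm⟩
      have : 0 ≤ θ * x o ⟨0, hm⟩ :=
        (mul_nonneg (zero_le_one.trans hδ) (hx j _).le).trans h0
      exact nonneg_of_mul_nonneg_left this (hx o _)
    · exact ⟨o, 1, self_mem_Ici, fun _ => le_rfl, fun r => (one_mul _).ge⟩
  have h2 : thetaEff x y o (Icc 0 1) < 1 := by
    have := hgirs.1
    have := hgirs.2
    linarith
  obtain ⟨θ, ⟨j, δ, hδ, hxx, hyy⟩, hθ⟩ := exists_lt_of_csInf_lt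
    (by exact ⟨1, o, 1, by simp, fun _ => le_rfl, fun r => (one_mul _).ge⟩) h2
  have hδ0 : 0 < δ := by
    have := hyy ⟨0, hs⟩
    exact pos_of_mul_pos_left ((hy o _).trans_le this) (hy j _).le
  have hb : 1 / δ ≤ betaRatio x y o j := by
    rw [le_beta_iff hs x y hy]
    intro r
    rw [div_mul_eq_mul_div, one_mul, div_le_iff₀ hδ0, mul_comm]
    exact hyy r
  refine ⟨j, lt_of_lt_of_le ?_ hb⟩
  rw [lt_div_iff₀ hδ0, one_mul]
  refine lt_of_le_of_ne hδ.2 ?_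
  rintro rfl
  refine heff ⟨(x j, y j), ⟨fun r => (hy j r).le, j, fun _ => le_rfl, fun _ => le_rfl⟩, ?_, ?_, ?_⟩
  · intro i
    have := hxx i
    have := hx o i
    show x j i ≤ x o i
    nlinarith
  · intro r
    simpa using hyy r
  · intro he
    have h1 : x j ⟨0, hm⟩ = x o ⟨0, hm⟩ := congrFun (congrArg Prod.fst he) _
    have := hxx ⟨0, hm⟩
    have := hx o ⟨0, hm⟩
    nlinarith

/-- under FDH_V-efficiency and G-IRS,
`σ_o^+ = max_{j ∈ Π} (β_{jo} - 1)/(α_{jo} - 1)` where `Π = {j : α_{jo} > 1}` is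
nonempty; in particular the supremum defining `σ_o^+` is finite and attained. -/
theorem stmt1 {n m s : ℕ} (hm : 0 < m) (hs : 0 < s)
    (x : Fin n → Fin m → ℝ) (y : Fin n → Fin s → ℝ)
    (hx : ∀ j i, 0 < x j i) (hy : ∀ j r, 0 < y j r)
    (o : Fin n) (heff : FDHEfficient x y o) (hgirs : GIRS x y o) :
    (∃ j : Fin n, 1 < alphaRatio x y o j) ∧
    BddAbove {ρ : ℝ | ∃ α : ℝ, 1 < α ∧ ρ = (respFun x y o α - 1) / (α - 1)} ∧
    (∃ α : ℝ, 1 < α ∧ sigmaPlus x y o = (respFun x y o α - 1) / (α - 1)) ∧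
    IsGreatest {ρ : ℝ | ∃ j : Fin n, 1 < alphaRatio x y o j ∧
        ρ = (betaRatio x y o j - 1) / (alphaRatio x y o j - 1)}
      (sigmaPlus x y o) := by
  have hE := eff_beta hm hs x y hx hy o heff
  obtain ⟨k, hk⟩ := girs_exists hm hs x y hx hy o heff hgirs
  set a := alphaRatio x y o with ha
  set b := betaRatio x y o with hb
  have hka := hE k hk
  have hset : ∀ α, {β : ℝ | ((fun i => α * x o i), (fun r => β * y o r)) ∈ FDH x y} =
      {β | 0 ≤ β ∧ ∃ j, a j ≤ α ∧ β ≤ b j} := fun α => by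
    ext β
    exact resp_set hm hs x y hx hy o α β
  have hbdd : ∀ α, BddAbove {β : ℝ | 0 ≤ β ∧ ∃ j, a j ≤ α ∧ β ≤ b j} := fun α => by
    obtain ⟨B, hB⟩ := (Set.finite_range b).bddAbove
    refine ⟨B, ?_⟩
    rintro β ⟨-, j, -, h⟩
    exact h.trans (hB ⟨j, rfl⟩)
  obtain ⟨q, hq, hmax⟩ := Finset.exists_max_image (Finset.univ.filter fun j => 1 < a j)
    (fun j => (b j - 1) / (a j - 1)) ⟨k, by simpa using hka⟩
  simp only [Finset.mem_filter, Finset.mem_univ, true_and] at hq hmax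
  set M := (b q - 1) / (a q - 1) with hM
  have hM0 : 0 < M := lt_of_lt_of_le (div_pos (by linarith) (by linarith)) (hmax k hka)
  have hle : ∀ α, 1 < α → (respFun x y o α - 1) / (α - 1) ≤ M := by
    intro α hα
    have hα1 : 0 < α - 1 := by linarith
    rw [div_le_iff₀ hα1, sub_le_iff_le_add]
    unfold respFun
    rw [hset]
    have hM1 : 0 < M * (α - 1) := mul_pos hM0 hα1
    apply Real.sSup_le _ (by linarith)
    rintro β ⟨-, j, hj, hβ⟩
    rcases le_or_gt (b j) 1 with h | h
    · linarith
    · have h1 := hE j h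
      have h2 := hmax j h1
      rw [div_le_iff₀ (by linarith)] at h2
      have : M * (a j - 1) ≤ M * (α - 1) := mul_le_mul_of_nonneg_left (by linarith) hM0.le
      linarith
  have hbq : 1 < b q := by
    have := (div_pos_iff_of_pos_right (show 0 < a q - 1 by linarith)).1 hM0
    linarith
  have heq : (respFun x y o (a q) - 1) / (a q - 1) = M := by
    refine le_antisymm (hle _ hq) ?_
    rw [hM]
    refine div_le_div_of_nonneg_right (sub_le_sub_right ?_ 1) (by linarith)
    unfold respFun
    rw [hset]
    exact le_csSup (hbdd _) ⟨by linarith, q, le_rfl, le_rfl⟩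
  have hgr : IsGreatest {ρ : ℝ | ∃ α : ℝ, 1 < α ∧ ρ = (respFun x y o α - 1) / (α - 1)} M := by
    refine ⟨⟨a q, hq, heq.symm⟩, ?_⟩
    rintro ρ ⟨α, hα, rfl⟩
    exact hle α hα
  have hsig : sigmaPlus x y o = M := hgr.csSup_eq
  rw [hsig]
  refine ⟨⟨k, hka⟩, ⟨M, hgr.2⟩, ⟨a q, hq, heq.symm⟩, ⟨q, hq, rfl⟩, ?_⟩
  rintro ρ ⟨j, hj, rfl⟩
  exact hmax j hj
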